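/- Let T be a spanning tree of a finite connected weighted graph G rooted at r, and let e1 and e2 be independent tree edges (Subtree(e1) and Subtree(e2) are disjoint). Then the weight of the cut given by S = Subtree(e1) ∪ Subtree(e2) equals w(F_{e1}) + w(F_{e2}) − 2·Σ w(f), where the sum ranges over all edges f of G with one endpoint in Subtree(e1) and the other endpoint in Subtree(e2). -/

import Mathlib

open SimpleGraph

/-- The crossing edges of the cut `S`: edges of `G` with exactly one endpoint in `S`. -/
def crossEdges {V : Type*} (G : SimpleGraph V) (S : Set V) : Set (Sym2 V) :=
  {f | f ∈ G.edgeSet ∧ ∃ x y, f = s(x, y) ∧ x ∈ S ∧ y ∉ S}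

/-- The total weight of a set of edges. -/
noncomputable def wSet {V : Type*} (w : Sym2 V → ℝ) (F : Set (Sym2 V)) : ℝ :=
  ∑ᶠ f ∈ F, w f

/-- The weight of the cut `S`. -/
noncomputable def cutWeight {V : Type*} (G : SimpleGraph V) (w : Sym2 V → ℝ) (S : Set V) : ℝ :=
  wSet w (crossEdges G S)

/-- The minimum cut weight of `G`: the minimum of `cutWeight` over all `S` with `∅ ⊊ S ⊊ V`. -/
noncomputable def minCut {V : Type*} (G : SimpleGraph V) (w : Sym2 V → ℝ) : ℝ :=
  sInf (cutWeight G w '' {S : Set V | S.Nonempty ∧ S ≠ Set.univ})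

/-- `F_e`: the set of edges `{x, y}` of `G` (tree and non-tree) whose unique path in `T`
between `x` and `y` contains the tree edge `e`. -/
def Fe {V : Type*} (G T : SimpleGraph V) (e : Sym2 V) : Set (Sym2 V) :=
  {f | f ∈ G.edgeSet ∧ ∃ x y, f = s(x, y) ∧ ∃ p : T.Walk x y, p.IsPath ∧ e ∈ p.edges}

/-- `Subtree(e)`: the vertices whose unique path in `T` to the root `r` passes through the
tree edge `e`; equivalently, the vertex set of the subtree of `T` rooted at the endpoint of
`e` farther from `r`. -/
def subtree {V : Type*} (T : SimpleGraph V) (r : V) (e : Sym2 V) : Set V :=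
  {x | ∃ p : T.Walk x r, p.IsPath ∧ e ∈ p.edges}

lemma aux_edge {V : Type*} {T : SimpleGraph V} (hT : T.IsTree) (e : Sym2 V) (x y : V) :
    (∃ p : T.Walk x y, p.IsPath ∧ e ∈ p.edges) ↔ ¬ (T.deleteEdges {e}).Reachable x y := by
  classical
  constructor
  · rintro ⟨p, hp, he⟩ ⟨q⟩
    obtain ⟨q', hq⟩ := q.toPath
    have hle : T.deleteEdges {e} ≤ T := T.deleteEdges_le {e}
    have h2 : (q'.mapLe hle).IsPath := hq.mapLe hle
    have h3 : p = q'.mapLe hle := (hT.existsUnique_path x y).unique hp h2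
    rw [h3, Walk.edges_mapLe_eq_edges] at he
    have := q'.edges_subset_edgeSet he
    simp at this
  · intro h
    obtain ⟨p, hp, -⟩ := hT.existsUnique_path x y
    refine ⟨p, hp, ?_⟩
    by_contra he
    exact h ⟨p.toDeleteEdge e he⟩

lemma aux_two {V : Type*} {T : SimpleGraph V} (a b x c : V) (p : T.Walk x c) (hc : c = a) :
    (T.deleteEdges {s(a, b)}).Reachable x a ∨ (T.deleteEdges {s(a, b)}).Reachable x b := by
  induction p with
  | nil => left; rw [hc]
  | @cons u v _ h p ih =>
    by_cases huv : s(u, v) = s(a, b)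
    · rcases Sym2.eq_iff.1 huv with ⟨rfl, rfl⟩ | ⟨rfl, rfl⟩
      · left; rfl
      · right; rfl
    · have : (T.deleteEdges {s(a, b)}).Adj u v := by
        rw [deleteEdges_adj]; exact ⟨h, huv⟩
      exact (ih hc).imp this.reachable.trans this.reachable.trans

lemma aux_xor {V : Type*} {T : SimpleGraph V} (hT : T.IsTree) (e : Sym2 V) (r x y : V) :
    (∃ p : T.Walk x y, p.IsPath ∧ e ∈ p.edges) ↔
      ¬ (x ∈ subtree T r e ↔ y ∈ subtree T r e) := by
  simp only [subtree, Set.mem_ofPred_eq, aux_edge hT]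
  induction e with | _ a b =>
  have h : ∀ z, (T.deleteEdges {s(a, b)}).Reachable z a ∨
      (T.deleteEdges {s(a, b)}).Reachable z b := fun z =>
    (hT.connected.preconnected z a).elim fun p => aux_two a b z a p rfl
  have tr : ∀ {u v w}, (T.deleteEdges {s(a, b)}).Reachable u v →
      (T.deleteEdges {s(a, b)}).Reachable v w → (T.deleteEdges {s(a, b)}).Reachable u w :=
    fun h h' => h.trans h'
  have sy : ∀ {u v}, (T.deleteEdges {s(a, b)}).Reachable u v →
      (T.deleteEdges {s(a, b)}).Reachable v u := fun h => h.symm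
  generalize (T.deleteEdges {s(a, b)}).Reachable = R at *
  have := h x
  have := h y
  have := h r
  grind

lemma aux_cross {V : Type*} (G : SimpleGraph V) (S : Set V) (x y : V) :
    s(x, y) ∈ crossEdges G S ↔ G.Adj x y ∧ ¬ (x ∈ S ↔ y ∈ S) := by
  simp only [crossEdges, Set.mem_ofPred_eq, mem_edgeSet]
  refine and_congr_right fun _ => ⟨?_, fun h => ?_⟩
  · rintro ⟨u, v, h, hu, hv⟩
    rcases Sym2.eq_iff.1 h with ⟨rfl, rfl⟩ | ⟨rfl, rfl⟩ <;> tauto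
  · by_cases hx : x ∈ S
    · exact ⟨x, y, rfl, hx, by tauto⟩
    · exact ⟨y, x, Sym2.eq_swap, by tauto, hx⟩

lemma aux_Fe {V : Type*} (G : SimpleGraph V) {T : SimpleGraph V} (hT : T.IsTree) (e : Sym2 V)
    (r x y : V) :
    s(x, y) ∈ Fe G T e ↔ G.Adj x y ∧ ¬ (x ∈ subtree T r e ↔ y ∈ subtree T r e) := by
  simp only [Fe, Set.mem_ofPred_eq, mem_edgeSet, aux_xor hT e r]
  refine and_congr_right fun _ => ⟨?_, fun h => ⟨x, y, rfl, h⟩⟩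
  rintro ⟨u, v, h, hu⟩
  rcases Sym2.eq_iff.1 h with ⟨rfl, rfl⟩ | ⟨rfl, rfl⟩ <;> tauto

lemma aux_between {V : Type*} (G : SimpleGraph V) (A B : Set V) (x y : V) :
    s(x, y) ∈ {f | f ∈ G.edgeSet ∧ ∃ x y : V, f = s(x, y) ∧ x ∈ A ∧ y ∈ B} ↔
      G.Adj x y ∧ ((x ∈ A ∧ y ∈ B) ∨ (y ∈ A ∧ x ∈ B)) := by
  simp only [Set.mem_ofPred_eq, mem_edgeSet]
  refine and_congr_right fun _ => ⟨?_, ?_⟩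
  · rintro ⟨u, v, h, hu⟩
    rcases Sym2.eq_iff.1 h with ⟨rfl, rfl⟩ | ⟨rfl, rfl⟩ <;> tauto
  · rintro (h | h)
    · exact ⟨x, y, rfl, h⟩
    · exact ⟨y, x, Sym2.eq_swap, h⟩

open Classical in
lemma aux_wSet {V : Type*} [Fintype V] (w : Sym2 V → ℝ) (F : Set (Sym2 V)) :
    wSet w F = ∑ f, if f ∈ F then w f else 0 := by
  rw [wSet, finsum_mem_def, finsum_eq_sum_of_fintype]
  rfl

theorem stmt10 {V : Type*} [Fintype V] (G T : SimpleGraph V) (w : Sym2 V → ℝ)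
    (hw : ∀ f, 0 ≤ w f) (hG : G.Connected) (hTG : T ≤ G) (hT : T.IsTree)
    (r : V) (e1 e2 : Sym2 V) (he1 : e1 ∈ T.edgeSet) (he2 : e2 ∈ T.edgeSet)
    (hindep : Disjoint (subtree T r e1) (subtree T r e2)) :
    cutWeight G w (subtree T r e1 ∪ subtree T r e2) =
      wSet w (Fe G T e1) + wSet w (Fe G T e2) -
        2 * wSet w {f | f ∈ G.edgeSet ∧ ∃ x y : V, f = s(x, y) ∧
          x ∈ subtree T r e1 ∧ y ∈ subtree T r e2} := by
  classical
  simp only [cutWeight, aux_wSet]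
  rw [Finset.mul_sum, ← Finset.sum_add_distrib, ← Finset.sum_sub_distrib]
  refine Finset.sum_congr rfl fun f _ => ?_
  induction f with | _ x y =>
  have hx : x ∈ subtree T r e1 → x ∉ subtree T r e2 := fun h => Set.disjoint_left.1 hindep h
  have hy : y ∈ subtree T r e1 → y ∉ subtree T r e2 := fun h => Set.disjoint_left.1 hindep h
  simp only [aux_cross, aux_Fe G hT _ r, aux_between, Set.mem_union]
  by_cases hxy : G.Adj x y <;> by_cases h1 : x ∈ subtree T r e1 <;>
    by_cases h2 : x ∈ subtree T r e2 <;> by_cases h3 : y ∈ subtree T r e1 <;>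
    by_cases h4 : y ∈ subtree T r e2 <;> simp_all <;> ring
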